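/- Let p ≥ 1, A ≥ 0, n ≥ 0 be integers and let P(k_1, …, k_p) be a polynomial with rational coefficients satisfying condition (9) with A_i = A, n_i = n, r_i = (p−i)(n+1) for all i. Then the series Σ_{k_1 ≥ … ≥ k_p ≥ 1} P(k_1, …, k_p) / ((k_1+(p−1)(n+1))_{n+1}^A (k_2+(p−2)(n+1))_{n+1}^A ⋯ (k_p)_{n+1}^A) is a ℚ-linear combination of multiple zeta values ζ(s_1, …, s_q) with 0 ≤ q ≤ p, s_1 ≥ 2, 1 ≤ s_i ≤ A for every i ∈ {1, …, q}, such that the number of i with s_i = 1 is not greater than the number of i ∈ {1, …, p} with deg_{k_i} P ≥ A(n+1) − 1. In particular, if deg_{k_i} P ≤ A(n+1) − 2 for every i ∈ {1, …, p}, then the series is a ℚ-linear combination of ζ(s_1, …, s_q) with 0 ≤ q ≤ p and 2 ≤ s_i ≤ A for every i ∈ {1, …, q}. -/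

import Mathlib

/-- The multiple zeta value `ζ(s₁, …, s_q)`, defined as a sum over strictly
decreasing tuples `k₁ > k₂ > … > k_q ≥ 1`.  For the empty list it equals `1`. -/
noncomputable def mzv (s : List ℕ) : ℝ :=
  ∑' k : {k : Fin s.length → ℕ // StrictAnti k ∧ ∀ i, 1 ≤ k i},
    ∏ i : Fin s.length, ((k.1 i : ℝ) ^ s.get i)⁻¹

section PolynomialDegree

open Polynomial

/-- `DegLE P z` says that `P` has degree at most the integer `z`; it means `P = 0` if `z < 0`. -/
def DegLE (P : ℚ[X]) (z : ℤ) : Prop := ∀ i : ℕ, z < i → P.coeff i = 0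

theorem DegLE.mono {P : ℚ[X]} {z w : ℤ} (h : DegLE P z) (hzw : z ≤ w) : DegLE P w :=
  fun i hi => h i (by lia)

theorem DegLE.add {P Q : ℚ[X]} {z : ℤ} (hP : DegLE P z) (hQ : DegLE Q z) : DegLE (P + Q) z :=
  fun i hi => by rw [coeff_add, hP i hi, hQ i hi, add_zero]

theorem DegLE.sub {P Q : ℚ[X]} {z : ℤ} (hP : DegLE P z) (hQ : DegLE Q z) : DegLE (P - Q) z :=
  fun i hi => by rw [coeff_sub, hP i hi, hQ i hi, sub_zero]

theorem DegLE.mul {P Q : ℚ[X]} {z w : ℤ} (hP : DegLE P z) (hQ : DegLE Q w) :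
    DegLE (P * Q) (z + w) := by
  intro i hi
  rw [coeff_mul]
  refine Finset.sum_eq_zero fun x hx => ?_
  rw [Finset.HasAntidiagonal.mem_antidiagonal] at hx
  by_cases h : z < x.1
  · rw [hP _ h, zero_mul]
  · rw [hQ x.2 (by lia), mul_zero]

theorem degLE_of_natDegree_le {P : ℚ[X]} {z : ℤ} (h : (P.natDegree : ℤ) ≤ z) : DegLE P z :=
  fun i hi => coeff_eq_zero_of_natDegree_lt (by lia)

theorem DegLE.natDegree_le {P : ℚ[X]} {z : ℤ} (h : DegLE P z) (hP : P ≠ 0) :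
    (P.natDegree : ℤ) ≤ z := by
  by_contra! hlt
  exact hP (leadingCoeff_eq_zero.mp (h _ hlt))

theorem degLE_zero (z : ℤ) : DegLE 0 z := fun i _ => coeff_zero i

theorem degLE_C (a : ℚ) : DegLE (C a) 0 := degLE_of_natDegree_le (by simp)

theorem DegLE.eq_zero {P : ℚ[X]} {z : ℤ} (h : DegLE P z) (hz : z < 0) : P = 0 := by
  ext i
  rw [h i (by lia), coeff_zero]

theorem DegLE.comp_X_add_C {P : ℚ[X]} {z : ℤ} (h : DegLE P z) (a : ℚ) :
    DegLE (P.comp (X + C a)) z := by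
  rcases eq_or_ne P 0 with rfl | hP
  · simpa using degLE_zero z
  · refine degLE_of_natDegree_le ?_
    rw [natDegree_comp, natDegree_X_add_C, mul_one]
    exact h.natDegree_le hP

theorem DegLE.of_mul_monic {P M : ℚ[X]} {z : ℤ} (hM : M.Monic)
    (h : DegLE (P * M) (z + M.natDegree)) : DegLE P z := by
  rcases eq_or_ne P 0 with rfl | hP
  · exact degLE_zero z
  · refine degLE_of_natDegree_le ?_
    have := h.natDegree_le (mul_ne_zero hP hM.ne_zero)
    rw [natDegree_mul hP hM.ne_zero] at this
    push_cast at this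
    lia

theorem DegLE.comp_sub {P : ℚ[X]} {z : ℤ} (h : DegLE P z) (a : ℚ) :
    DegLE (P.comp (X + C a) - P) (z - 1) := by
  rcases eq_or_ne P 0 with rfl | hP
  · simpa using degLE_zero _
  · have hc : P.comp (X + C a) ≠ 0 := by
      intro h0
      have := congrArg leadingCoeff h0
      rw [leadingCoeff_comp (by simp)] at this
      simp [hP] at this
    have hdeg : (P.comp (X + C a)).degree = P.degree := by
      rw [degree_eq_natDegree hc, degree_eq_natDegree hP, natDegree_comp, natDegree_X_add_C,
        mul_one]
    have hlt := degree_sub_lt_left hdeg hc (by rw [leadingCoeff_comp (by simp)]; simp)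
    intro i hi
    refine coeff_eq_zero_of_degree_lt (hlt.trans_le ?_)
    rw [hdeg, degree_eq_natDegree hP]
    have := h.natDegree_le hP
    exact_mod_cast (by lia : P.natDegree ≤ i)

theorem DegLE.X_mul_pow {P : ℚ[X]} {z : ℤ} (h : DegLE P z) (a : ℚ) (m : ℕ) :
    DegLE (P * (X + C a) ^ m) (z + m) :=
  h.mul (degLE_of_natDegree_le (by rw [natDegree_pow, natDegree_X_add_C, mul_one]))

/-- Every polynomial is a forward difference of a polynomial of degree one more. -/
theorem DegLE.exists_antidifference {P : ℚ[X]} {z : ℤ} (h : DegLE P z) :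
    ∃ F : ℚ[X], DegLE F (z + 1) ∧ ∀ x : ℚ, P.eval x = F.eval (x + 1) - F.eval x := by
  refine ⟨∑ i ∈ P.support, C (P.coeff i / (i + 1)) * Polynomial.bernoulli (i + 1), ?_, ?_⟩
  · intro i hi
    rw [finsetSum_coeff]
    refine Finset.sum_eq_zero fun j hj => ?_
    have hj' : (j : ℤ) ≤ z := by
      by_contra! hlt
      exact (mem_support_iff.mp hj) (h j hlt)
    rw [coeff_C_mul, coeff_bernoulli, if_neg (by lia), mul_zero]
  · intro x
    rw [eval_finsetSum, eval_finsetSum, ← Finset.sum_sub_distrib, eval_eq_sum, Polynomial.sum]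
    refine Finset.sum_congr rfl fun i _ => ?_
    rw [eval_mul, eval_mul, add_comm x 1, bernoulli_eval_one_add, eval_C, eval_C]
    have : (i : ℚ) + 1 ≠ 0 := by positivity
    rw [Nat.add_sub_cancel, Nat.cast_add_one, mul_add, ← mul_assoc, div_mul_cancel₀ _ this]
    ring

/-- The polynomial `∏_{j < b} (x + 1 + j) ^ A`. -/
noncomputable def polePoly (A b : ℕ) : ℚ[X] := ∏ j ∈ Finset.range b, (X + C (1 + j : ℚ)) ^ A

theorem polePoly_succ (A b : ℕ) : polePoly A (b + 1) = polePoly A b * (X + C (1 + b : ℚ)) ^ A :=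
  Finset.prod_range_succ _ _

theorem polePoly_monic (A b : ℕ) : (polePoly A b).Monic :=
  monic_prod_of_monic _ _ fun _ _ => (monic_X_add_C _).pow _

theorem natDegree_polePoly (A b : ℕ) : (polePoly A b).natDegree = A * b := by
  rw [polePoly, natDegree_prod_of_monic _ _ fun _ _ => (monic_X_add_C _).pow _]
  simp only [natDegree_pow, natDegree_X_add_C, mul_one, Finset.sum_const, Finset.card_range,
    smul_eq_mul, mul_comm]

theorem degLE_polePoly (A b : ℕ) : DegLE (polePoly A b) (A * b : ℕ) :=
  degLE_of_natDegree_le (by rw [natDegree_polePoly])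

theorem eval_polePoly (A b : ℕ) (x : ℚ) :
    (polePoly A b).eval x = ∏ j ∈ Finset.range b, (x + 1 + j) ^ A := by
  simp [polePoly, eval_prod, add_assoc]

theorem eval_polePoly_pos (A b x : ℕ) : 0 < (polePoly A b).eval (x : ℚ) := by
  rw [eval_polePoly]
  exact Finset.prod_pos fun j _ => by positivity

theorem polePoly_comp (A b : ℕ) :
    (polePoly A b).comp (X + C 1) * (X + C 1) ^ A = polePoly A (b + 1) := by
  rw [polePoly, polePoly, Finset.prod_range_succ', Polynomial.prod_comp]
  congr 1
  · refine Finset.prod_congr rfl fun j _ => ?_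
    simp only [pow_comp, add_comp, X_comp, C_comp]
    congr 1
    push_cast
    simp only [map_add]
    ring
  · simp

theorem isCoprime_polePoly (A b : ℕ) : IsCoprime (polePoly A b) ((X + C (1 + b : ℚ)) ^ A) := by
  refine IsCoprime.prod_left fun j hj => IsCoprime.pow ?_
  have hjb : (j : ℚ) ≠ b := by exact_mod_cast (Finset.mem_range.mp hj).ne
  refine ⟨C ((j - b : ℚ)⁻¹), - C ((j - b : ℚ)⁻¹), ?_⟩
  have : (j : ℚ) - b ≠ 0 := sub_ne_zero.mpr hjb
  calc _ = C ((j - b : ℚ)⁻¹) * C (j - b : ℚ) := by simp only [map_add, map_sub]; ring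
    _ = 1 := by rw [← C_mul, inv_mul_cancel₀ this, C_1]

/-- `IsRat A b d f`: on the natural numbers, `f` is a rational function of degree at most `d`,
with poles of order at most `A` at `-1, …, -b` and no others. -/
def IsRat (A b : ℕ) (d : ℤ) (f : ℕ → ℚ) : Prop :=
  ∃ P : ℚ[X], DegLE P (A * b + d) ∧ ∀ x : ℕ, f x = P.eval (x : ℚ) / (polePoly A b).eval (x : ℚ)

variable {A b : ℕ} {d : ℤ} {f g : ℕ → ℚ}

theorem IsRat.mono {d' : ℤ} (hf : IsRat A b d f) (h : d ≤ d') : IsRat A b d' f :=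
  let ⟨P, hP, hf⟩ := hf
  ⟨P, hP.mono (by lia), hf⟩

theorem IsRat.add (hf : IsRat A b d f) (hg : IsRat A b d g) : IsRat A b d (fun x => f x + g x) :=
  let ⟨P, hP, hf⟩ := hf
  let ⟨Q, hQ, hg⟩ := hg
  ⟨P + Q, hP.add hQ, fun x => by simp only [hf, hg, eval_add, add_div]⟩

theorem isRat_const (A b : ℕ) (a : ℚ) : IsRat A b 0 (fun _ => a) :=
  ⟨C a * polePoly A b, by
    simpa using (degLE_C a).mul (degLE_polePoly A b), fun x => by
    rw [eval_mul, eval_C, mul_div_cancel_right₀ _ (eval_polePoly_pos A b x).ne']⟩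

theorem IsRat.mul_of_poles {b' : ℕ} {d' : ℤ} {Q M : ℚ[X]} (hf : IsRat A b d f) (hQ : DegLE Q d')
    (hM : polePoly A b * M = polePoly A b') (hg : ∀ x : ℕ, g x = Q.eval (x : ℚ) / M.eval (x : ℚ)) :
    IsRat A b' (d + d' - M.natDegree) (fun x => g x * f x) := by
  obtain ⟨P, hP, hf⟩ := hf
  have hM0 : M ≠ 0 := right_ne_zero_of_mul (hM ▸ (polePoly_monic A b').ne_zero)
  have hdeg := congrArg natDegree hM
  rw [natDegree_mul (polePoly_monic A b).ne_zero hM0, natDegree_polePoly, natDegree_polePoly]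
    at hdeg
  refine ⟨P * Q, (hP.mul hQ).mono ?_, fun x => ?_⟩
  · have : (A * b : ℤ) + M.natDegree = A * b' := by exact_mod_cast hdeg
    lia
  · simp only [hf, hg]
    rw [← hM, eval_mul, eval_mul, div_mul_div_comm, mul_comm, mul_comm (eval _ M)]

theorem IsRat.succ_poles (hf : IsRat A b d f) : IsRat A (b + 1) d f := by
  have := hf.mul_of_poles (g := fun _ => 1) (Q := (X + C (1 + b : ℚ)) ^ A) (d' := A)
    (M := (X + C (1 + b : ℚ)) ^ A) (b' := b + 1)
    (degLE_of_natDegree_le (by rw [natDegree_pow, natDegree_X_add_C, mul_one]))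
    (polePoly_succ A b).symm (fun x => by
      rw [div_self]
      simp only [eval_pow, eval_add, eval_X, eval_C]
      positivity)
  rw [natDegree_pow, natDegree_X_add_C, mul_one, add_sub_cancel_right] at this
  simpa only [one_mul] using this

theorem IsRat.shift_mul_inv_pow (hf : IsRat A b d f) {s : ℕ} (hs : s ≤ A) :
    IsRat A (b + 1) (d - s) (fun x => ((x + 1 : ℚ) ^ s)⁻¹ * f (x + 1)) := by
  obtain ⟨P, hP, hf⟩ := hf
  refine ⟨P.comp (X + C 1) * (X + C 1) ^ (A - s),
    ((hP.comp_X_add_C 1).X_mul_pow 1 (A - s)).mono ?_, fun x => ?_⟩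
  · push_cast [hs]
    lia
  · rw [← polePoly_comp]
    simp only [hf]
    simp only [eval_mul, eval_comp, eval_add, eval_X, eval_C, eval_pow]
    push_cast
    have h1 : (polePoly A b).eval ((x : ℚ) + 1) ≠ 0 := by
      exact_mod_cast (eval_polePoly_pos A b (x + 1)).ne'
    have h2 : (x : ℚ) + 1 ≠ 0 := by positivity
    obtain ⟨t, rfl⟩ := Nat.exists_eq_add_of_le hs
    rw [Nat.add_sub_cancel_left, pow_add]
    field_simp

/-- The outermost pole of a rational function can be moved inwards by subtracting a forward
difference. -/
theorem IsRat.exists_remove_pole (hd : -2 ≤ d) (hf : IsRat A (b + 2) d f) :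
    ∃ F g : ℕ → ℚ, IsRat A (b + 1) (-1) F ∧ IsRat A (b + 1) d g ∧
      ∀ x, f x = g x + (F (x + 1) - F x) := by
  obtain ⟨P, hP, hf⟩ := hf
  set M : ℚ[X] := (X + C (1 + (b + 1 : ℕ) : ℚ)) ^ A with hMdef
  have hMm : M.Monic := (monic_X_add_C _).pow _
  have hMd : M.natDegree = A := by rw [hMdef, natDegree_pow, natDegree_X_add_C, mul_one]
  have hMc : M.comp (X + C (-1)) = (X + C (1 + b : ℚ)) ^ A := by
    simp only [hMdef, pow_comp, add_comp, X_comp, C_comp]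
    congr 1
    rw [add_assoc, ← C_add]
    congr 2
    push_cast
    ring
  have hsucc : polePoly A (b + 2) = polePoly A (b + 1) * M := polePoly_succ A (b + 1)
  obtain ⟨u, v, huv⟩ := isCoprime_polePoly A (b + 1)
  rw [← hMdef] at huv
  set c : ℚ[X] := (P * u) %ₘ M with hc
  have hcdeg : DegLE c (A - 1) := by
    intro i hi
    refine coeff_eq_zero_of_degree_lt ((degree_modByMonic_lt _ hMm).trans_le ?_)
    rw [degree_eq_natDegree hMm.ne_zero, hMd]
    exact_mod_cast (by lia : A ≤ i)
  set w : ℚ[X] := P * v + (P * u /ₘ M) * polePoly A (b + 1) with hw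
  have hPw : P = c * polePoly A (b + 1) + w * M := by
    have h1 := modByMonic_add_div (P * u) M
    calc P = (P * u) * polePoly A (b + 1) + P * v * M := by
          linear_combination -P * huv
      _ = _ := by
          rw [hw]
          linear_combination -polePoly A (b + 1) * h1
  set G : ℚ[X] := w + c.comp (X + C (-1)) * polePoly A b with hG
  have hGM : G * M = P - polePoly A b *
      (c * (M.comp (X + C (-1)) - M) - (c.comp (X + C (-1)) - c) * M) := by
    rw [hG, hPw, hMc, polePoly_succ A b]
    ring
  have hMdeg : DegLE M A := degLE_of_natDegree_le (by rw [hMd])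
  have hGdeg : DegLE G (A * (b + 1 : ℕ) + d) := by
    refine DegLE.of_mul_monic hMm ?_
    rw [hGM, hMd]
    refine DegLE.sub (hP.mono (by push_cast; lia)) (((degLE_polePoly A b).mul
      (DegLE.sub (z := 2 * A - 2) ((hcdeg.mul (hMdeg.comp_sub (-1))).mono (by lia))
        (((hcdeg.comp_sub (-1)).mul hMdeg).mono (by lia)))).mono ?_)
    push_cast
    lia
  refine ⟨fun x => (c.comp (X + C (-1)) * polePoly A b).eval (x : ℚ) /
    (polePoly A (b + 1)).eval (x : ℚ), fun x => G.eval (x : ℚ) / (polePoly A (b + 1)).eval (x : ℚ),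
    ⟨_, ?_, fun _ => rfl⟩, ⟨_, hGdeg, fun _ => rfl⟩, fun x => ?_⟩
  · refine ((hcdeg.comp_X_add_C (-1)).mul (degLE_polePoly A b)).mono ?_
    push_cast
    lia
  · have hx := (eval_polePoly_pos A b x).ne'
    have hx1 : ((x : ℚ) + 1 + b) ^ A ≠ 0 := by positivity
    have hx2 : ((x : ℚ) + 1 + (b + 1)) ^ A ≠ 0 := by positivity
    have hx3 : (polePoly A b).eval ((x : ℚ) + 1) ≠ 0 := by
      exact_mod_cast (eval_polePoly_pos A b (x + 1)).ne'
    have e1 : (polePoly A (b + 1)).eval ((x + 1 : ℕ) : ℚ) =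
        (polePoly A b).eval ((x : ℚ) + 1) * ((x : ℚ) + 1 + (b + 1)) ^ A := by
      rw [polePoly_succ]
      simp only [eval_mul, eval_pow, eval_add, eval_X, eval_C]
      push_cast
      ring
    have e2 : (polePoly A (b + 1)).eval (x : ℚ) =
        (polePoly A b).eval (x : ℚ) * ((x : ℚ) + 1 + b) ^ A := by
      rw [polePoly_succ]
      simp only [eval_mul, eval_pow, eval_add, eval_X, eval_C]
      ring
    have e3 : M.eval (x : ℚ) = ((x : ℚ) + 1 + (b + 1)) ^ A := by
      simp only [hMdef, eval_pow, eval_add, eval_X, eval_C]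
      push_cast
      ring
    rw [hf, hPw, hsucc, hG]
    simp only [eval_mul, eval_add, eval_comp, eval_X, eval_C]
    rw [e1, e2, e3]
    push_cast
    rw [add_neg_cancel_right]
    field_simp
    ring

/-- A rational function is a combination of `(x + 1) ^ (-s)`, up to a forward difference. -/
theorem IsRat.exists_reduction (hd : -2 ≤ d) (hf : IsRat A (b + 1) d f) :
    ∃ (c : ℕ → ℚ) (F : ℕ → ℚ), IsRat A b (if 0 ≤ d then d + 1 else -1) F ∧
      (d ≤ -2 → c 1 = 0) ∧
      ∀ x : ℕ, f x = ∑ s ∈ Finset.Icc 1 A, c s * ((x + 1 : ℚ) ^ s)⁻¹ + (F (x + 1) - F x) := by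
  induction b generalizing f with
  | zero =>
    obtain ⟨P, hP, hf⟩ := hf
    set R : ℚ[X] := P.comp (X + C (-1)) with hR
    have hRdeg : DegLE R (A + d) := (hP.comp_X_add_C (-1)).mono (by simp)
    set r : ℚ[X] := R %ₘ X ^ A with hr
    set q : ℚ[X] := R /ₘ X ^ A with hq
    have hrdeg : r.degree < A := by
      simpa using degree_modByMonic_lt R (monic_X_pow (R := ℚ) A)
    have hrdeg' : DegLE r (A - 1) := fun i hi =>
      coeff_eq_zero_of_degree_lt (hrdeg.trans_le (by exact_mod_cast (by lia : A ≤ i)))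
    have hqr : r + X ^ A * q = R := modByMonic_add_div R _
    have hqdeg : DegLE q (if 0 ≤ d then d else -1) := by
      refine DegLE.of_mul_monic (monic_X_pow A) ?_
      rw [show q * X ^ A = R - r by rw [← hqr]; ring, natDegree_X_pow]
      refine DegLE.sub (hRdeg.mono ?_) (hrdeg'.mono ?_) <;> split_ifs <;> lia
    have hfx : ∀ x : ℕ, f x = ∑ s ∈ Finset.Icc 1 A, r.coeff (A - s) * ((x + 1 : ℚ) ^ s)⁻¹ +
        q.eval ((x : ℚ) + 1) := by
      intro x
      have hx : (x : ℚ) + 1 ≠ 0 := by positivity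
      have hPR : P.eval (x : ℚ) = R.eval ((x : ℚ) + 1) := by simp [hR]
      have hrx : r.eval ((x : ℚ) + 1) / ((x : ℚ) + 1) ^ A =
          ∑ s ∈ Finset.Icc 1 A, r.coeff (A - s) * ((x + 1 : ℚ) ^ s)⁻¹ := by
        have hev : r.eval ((x : ℚ) + 1) = ∑ i ∈ Finset.range A, r.coeff i * ((x : ℚ) + 1) ^ i := by
          rcases eq_or_ne r 0 with h0 | h0
          · simp [h0]
          · exact eval_eq_sum_range' ((natDegree_lt_iff_degree_lt h0).mpr hrdeg) _
        rw [hev, Finset.sum_div]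
        refine Finset.sum_nbij' (fun i => A - i) (fun s => A - s) ?_ ?_ ?_ ?_ ?_
        · intro i hi
          simp only [Finset.mem_range, Finset.mem_Icc] at hi ⊢
          lia
        · intro i hi
          simp only [Finset.mem_range, Finset.mem_Icc] at hi ⊢
          lia
        · intro i hi
          simp only [Finset.mem_range] at hi
          lia
        · intro i hi
          simp only [Finset.mem_Icc] at hi
          lia
        · intro i hi
          simp only [Finset.mem_range] at hi
          obtain ⟨t, rfl⟩ := Nat.exists_eq_add_of_le hi.le
          rw [Nat.add_sub_cancel_left, Nat.add_sub_cancel, pow_add]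
          field_simp
      rw [hf, hPR, eval_polePoly, ← hrx, ← hqr]
      simp only [eval_add, eval_mul, eval_pow, eval_X, zero_add, Finset.prod_range_one,
        Nat.cast_zero, add_zero]
      field_simp
    obtain ⟨F, hFdeg, hF⟩ := hqdeg.exists_antidifference
    have hF' : ∃ F : ℚ[X], DegLE F (if 0 ≤ d then d + 1 else -1) ∧
        ∀ x : ℚ, q.eval x = F.eval (x + 1) - F.eval x := by
      split_ifs at hqdeg hFdeg ⊢ with h
      · exact ⟨F, hFdeg, hF⟩
      · exact ⟨0, degLE_zero _, fun x => by rw [hqdeg.eq_zero (by lia)]; simp⟩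
    obtain ⟨F, hFdeg, hF⟩ := hF'
    refine ⟨fun s => r.coeff (A - s), fun x => F.eval ((x : ℚ) + 1),
      ⟨F.comp (X + C 1), (hFdeg.comp_X_add_C 1).mono (by simp), fun x => by
        simp [polePoly, eval_comp]⟩, fun hd2 => ?_, fun x => ?_⟩
    · have hq0 : q = 0 := by
        rw [if_neg (by lia)] at hqdeg
        exact hqdeg.eq_zero (by lia)
      rw [hq0, mul_zero, add_zero] at hqr
      rw [hqr]
      exact hRdeg _ (by lia)
    · rw [hfx, hF]
      push_cast
      rfl
  | succ b ih =>
    obtain ⟨F₁, g, hF₁, hg, hfg⟩ := hf.exists_remove_pole hd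
    obtain ⟨c, F₂, hF₂, hc, hg'⟩ := ih hg
    refine ⟨c, fun x => F₂ x + F₁ x, hF₂.succ_poles.add (hF₁.mono ?_), hc, fun x => ?_⟩
    · split_ifs <;> lia
    · rw [hfg, hg']
      ring

end PolynomialDegree

section TruncatedSums

/-- The nested sum `∑_{K > x₁ > x₂ > … > x_q ≥ 0} f₁(x₁) ⋯ f_q(x_q)`. -/
def nestedSum : List (ℕ → ℚ) → ℕ → ℚ
  | [], _ => 1
  | f :: L, K => ∑ x ∈ Finset.range K, f x * nestedSum L x

/-- The function `x ↦ (x + 1) ^ (-s)`. -/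
def invPow (s : ℕ) (x : ℕ) : ℚ := ((x + 1 : ℚ) ^ s)⁻¹

/-- Truncated multiple harmonic sums. -/
def harmonicSum (s : List ℕ) : ℕ → ℚ := nestedSum (s.map invPow)

theorem harmonicSum_cons (a : ℕ) (s : List ℕ) (K : ℕ) :
    harmonicSum (a :: s) K = ∑ x ∈ Finset.range K, invPow a x * harmonicSum s x := rfl

theorem harmonicSum_nil (K : ℕ) : harmonicSum [] K = 1 := rfl

theorem sum_range_mul_of_reduction {A : ℕ} {f F c : ℕ → ℚ}
    (h : ∀ x : ℕ, f x = ∑ s ∈ Finset.Icc 1 A, c s * ((x + 1 : ℚ) ^ s)⁻¹ + (F (x + 1) - F x))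
    (s : List ℕ) (K : ℕ) :
    ∑ x ∈ Finset.range K, f x * harmonicSum s x =
      ∑ σ ∈ Finset.Icc 1 A, c σ * harmonicSum (σ :: s) K +
        ∑ x ∈ Finset.range K, (F (x + 1) - F x) * harmonicSum s x := by
  simp only [h, add_mul, Finset.sum_add_distrib, harmonicSum_cons, Finset.mul_sum, Finset.sum_mul,
    invPow]
  rw [Finset.sum_comm]
  simp only [mul_assoc]

theorem sum_range_sub_nil (F : ℕ → ℚ) (K : ℕ) :
    ∑ x ∈ Finset.range K, (F (x + 1) - F x) * harmonicSum [] x = F K - F 0 := by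
  simp only [harmonicSum_nil, mul_one]
  exact Finset.sum_range_sub F K

theorem sum_range_sub_cons (F : ℕ → ℚ) (a : ℕ) (s : List ℕ) (K : ℕ) :
    ∑ x ∈ Finset.range K, (F (x + 1) - F x) * harmonicSum (a :: s) x =
      F K * harmonicSum (a :: s) K -
        ∑ x ∈ Finset.range K, (((x + 1 : ℚ) ^ a)⁻¹ * F (x + 1)) * harmonicSum s x := by
  induction K with
  | zero => simp [harmonicSum_cons]
  | succ K ih =>
    rw [Finset.sum_range_succ, ih, Finset.sum_range_succ, harmonicSum_cons a s (K + 1),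
      Finset.sum_range_succ, ← harmonicSum_cons, invPow]
    ring

/-- The span of the functions `K ↦ f(K) H_s(K)`, where `f` is rational with poles in `{-1, …, -b}`
and of degree at most `δ`, and where the number of ones in `s`, increased by one if the degree
of `f` is positive, is at most `u`. -/
def tailSpan (A b q : ℕ) (δ : ℤ) (u : ℕ) : Submodule ℚ (ℕ → ℚ) :=
  Submodule.span ℚ {g | ∃ (f : ℕ → ℚ) (d : ℤ) (s : List ℕ), IsRat A b d f ∧ d ≤ δ ∧
    s.length ≤ q ∧ (∀ a ∈ s, 1 ≤ a ∧ a ≤ A) ∧ s.count 1 + (if 0 < d then 1 else 0) ≤ u ∧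
    g = fun K => f K * harmonicSum s K}

theorem tailSpan_mono {A b q q' : ℕ} {δ δ' : ℤ} {u u' : ℕ} (hq : q ≤ q') (hδ : δ ≤ δ')
    (hu : u ≤ u') : tailSpan A b q δ u ≤ tailSpan A b q' δ' u' :=
  Submodule.span_mono fun _ ⟨f, d, s, hf, hd, hs, hA, hc, hg⟩ =>
    ⟨f, d, s, hf, hd.trans hδ, hs.trans hq, hA, hc.trans hu, hg⟩

theorem mem_tailSpan {A b q : ℕ} {δ : ℤ} {u : ℕ} {f : ℕ → ℚ} {d : ℤ} {s : List ℕ}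
    (hf : IsRat A b d f) (hd : d ≤ δ) (hs : s.length ≤ q) (hA : ∀ a ∈ s, 1 ≤ a ∧ a ≤ A)
    (hc : s.count 1 + (if 0 < d then 1 else 0) ≤ u) :
    (fun K => f K * harmonicSum s K) ∈ tailSpan A b q δ u :=
  Submodule.subset_span ⟨f, d, s, hf, hd, hs, hA, hc, rfl⟩

theorem const_mul_harmonicSum_mem_tailSpan {A b q : ℕ} {δ : ℤ} {u : ℕ} {s : List ℕ} (a : ℚ)
    (hδ : 0 ≤ δ) (hs : s.length ≤ q) (hA : ∀ a ∈ s, 1 ≤ a ∧ a ≤ A) (hc : s.count 1 ≤ u) :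
    (fun K => a * harmonicSum s K) ∈ tailSpan A b q δ u :=
  mem_tailSpan (isRat_const A b a) hδ hs hA (by simpa using hc)

theorem sum_mul_harmonicSum_mem_tailSpan {A b : ℕ} (s : List ℕ) (hs : ∀ a ∈ s, 1 ≤ a ∧ a ≤ A)
    {d : ℤ} {f : ℕ → ℚ} (hf : IsRat A (b + 1) d f) :
    (fun K => ∑ x ∈ Finset.range K, f x * harmonicSum s x) ∈
      tailSpan A b (s.length + 1) (max 0 (d + 1)) (s.count 1 + if -1 ≤ d then 1 else 0) := by
  induction s generalizing d f with
  | nil =>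
    obtain ⟨c, F, hF, hc, hfx⟩ := (hf.mono (le_max_left d (-2))).exists_reduction
      (le_max_right d (-2))
    have hsum : (fun K => ∑ x ∈ Finset.range K, f x * harmonicSum [] x) =
        (∑ σ ∈ Finset.Icc 1 A, fun K => c σ * harmonicSum [σ] K) +
          ((fun K => F K * harmonicSum [] K) + fun K => -F 0 * harmonicSum [] K) := by
      funext K
      rw [sum_range_mul_of_reduction hfx, sum_range_sub_nil]
      simp only [Pi.add_apply, Finset.sum_apply, harmonicSum_nil]
      ring
    rw [hsum]
    refine Submodule.add_mem _ (Submodule.sum_mem _ fun σ hσ => ?_) (Submodule.add_mem _ ?_ ?_)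
    · rw [Finset.mem_Icc] at hσ
      by_cases h1 : σ = 1 ∧ ¬ -1 ≤ d
      · rw [h1.1, hc (by lia)]
        simp only [zero_mul]
        exact Submodule.zero_mem _
      · refine const_mul_harmonicSum_mem_tailSpan _ (le_max_left _ _) (by simp)
          (by simpa using hσ) ?_
        rw [List.count_singleton]
        simp only [beq_iff_eq, List.count_nil]
        split_ifs <;> lia
    · refine mem_tailSpan hF ?_ (by simp) (by simp) ?_
      · split_ifs <;> lia
      · simp only [List.count_nil]
        split_ifs <;> lia
    · exact const_mul_harmonicSum_mem_tailSpan _ (le_max_left _ _) (by simp) (by simp) (by simp)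
  | cons a s ih =>
    obtain ⟨c, F, hF, hc, hfx⟩ := (hf.mono (le_max_left d (-2))).exists_reduction
      (le_max_right d (-2))
    have hsum : (fun K => ∑ x ∈ Finset.range K, f x * harmonicSum (a :: s) x) =
        (∑ σ ∈ Finset.Icc 1 A, fun K => c σ * harmonicSum (σ :: a :: s) K) +
          ((fun K => F K * harmonicSum (a :: s) K) - fun K => ∑ x ∈ Finset.range K,
            (((x + 1 : ℚ) ^ a)⁻¹ * F (x + 1)) * harmonicSum s x) := by
      funext K
      rw [sum_range_mul_of_reduction hfx, sum_range_sub_cons]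
      simp only [Pi.add_apply, Pi.sub_apply, Finset.sum_apply]
    have ha := hs a (by simp)
    have hs' : ∀ a ∈ s, 1 ≤ a ∧ a ≤ A := fun a h => hs a (by simp [h])
    rw [hsum]
    refine Submodule.add_mem _ (Submodule.sum_mem _ fun σ hσ => ?_) (Submodule.sub_mem _ ?_ ?_)
    · rw [Finset.mem_Icc] at hσ
      by_cases h1 : σ = 1 ∧ ¬ -1 ≤ d
      · rw [h1.1, hc (by lia)]
        simp only [zero_mul]
        exact Submodule.zero_mem _
      · refine const_mul_harmonicSum_mem_tailSpan _ (le_max_left _ _) (by simp) ?_ ?_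
        · intro x hx
          rcases List.mem_cons.mp hx with rfl | hx
          · exact hσ
          · exact hs x hx
        · rw [List.count_cons (a := 1) (b := σ)]
          simp only [beq_iff_eq]
          split_ifs <;> lia
    · refine mem_tailSpan hF ?_ (by simp) hs ?_
      · split_ifs <;> lia
      · split_ifs <;> lia
    · refine tailSpan_mono (by simp) ?_ ?_ (ih hs' (hF.shift_mul_inv_pow ha.2))
      · split_ifs <;> lia
      · rw [List.count_cons]
        simp only [beq_iff_eq]
        split_ifs <;> lia

theorem IsRat.mul_monomial {A b n e t : ℕ} {d : ℤ} {f : ℕ → ℚ} (hf : IsRat A b d f) :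
    IsRat A (b + (n + 1)) (d + e - A * (n + 1)) (fun x =>
      ((x : ℚ) + 1 - t) ^ e / (∏ j ∈ Finset.range (n + 1), ((x : ℚ) + 1 + b + j)) ^ A * f x) := by
  have hnat : (∏ j ∈ Finset.range (n + 1), (Polynomial.X + Polynomial.C (1 + (b + j : ℕ) : ℚ)) ^ A
      ).natDegree = A * (n + 1) := by
    rw [Polynomial.natDegree_prod_of_monic _ _ fun _ _ => (Polynomial.monic_X_add_C _).pow _]
    simp only [Polynomial.natDegree_pow, Polynomial.natDegree_X_add_C, mul_one, Finset.sum_const,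
      Finset.card_range, smul_eq_mul, mul_comm]
  have := hf.mul_of_poles (b' := b + (n + 1)) (d' := e)
    (Q := (Polynomial.X + Polynomial.C (1 - t : ℚ)) ^ e)
    (M := ∏ j ∈ Finset.range (n + 1), (Polynomial.X + Polynomial.C (1 + (b + j : ℕ) : ℚ)) ^ A)
    (g := fun x => ((x : ℚ) + 1 - t) ^ e /
      (∏ j ∈ Finset.range (n + 1), ((x : ℚ) + 1 + b + j)) ^ A)
    (degLE_of_natDegree_le (by rw [Polynomial.natDegree_pow, Polynomial.natDegree_X_add_C,
      mul_one]))
    (by simp only [polePoly, Finset.prod_range_add]) (fun x => by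
      simp only [Polynomial.eval_prod, Polynomial.eval_pow, Polynomial.eval_add,
        Polynomial.eval_X, Polynomial.eval_C, Finset.prod_pow]
      push_cast
      simp only [add_assoc, add_sub_assoc])
  rw [hnat] at this
  exact_mod_cast this

/-- The factors of the summand for a monomial, in the strictly decreasing summation variables;
`e` lists the exponents of the monomial. -/
def monomialFactors (A n : ℕ) : List ℕ → List (ℕ → ℚ)
  | [] => []
  | e :: L => (fun x => ((x : ℚ) + 1 - L.length) ^ e /
      (∏ j ∈ Finset.range (n + 1), ((x : ℚ) + 1 + (L.length * n : ℕ) + j)) ^ A) ::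
        monomialFactors A n L

theorem nestedSum_monomialFactors_mem_tailSpan {A n : ℕ} (L : List ℕ) {δ : ℤ}
    (hδ : ∀ j ≤ L.length, ((L.take j).map fun e : ℕ => (e + 1 - A * (n + 1) : ℤ)).sum ≤ δ) :
    nestedSum (monomialFactors A n L) ∈ tailSpan A (L.length * n) L.length δ
      (L.countP fun e => A * (n + 1) ≤ e + 1) := by
  induction L generalizing δ with
  | nil =>
    have h0 : nestedSum (monomialFactors A n []) = fun K => 1 * harmonicSum [] K := by
      funext K
      simp [monomialFactors, nestedSum, harmonicSum_nil]
    rw [h0]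
    exact const_mul_harmonicSum_mem_tailSpan 1 (by simpa using hδ 0) (by simp) (by simp) (by simp)
  | cons e L ih =>
    have h0 : 0 ≤ δ := by simpa using hδ 0 (by simp)
    have ih' := ih (δ := δ - (e + 1 - A * (n + 1))) fun j hj => by
      have := hδ (j + 1) (by simpa using hj)
      simp only [List.take_succ_cons, List.map_cons, List.sum_cons] at this
      lia
    have key : ∀ g ∈ tailSpan A (L.length * n) L.length (δ - (e + 1 - A * (n + 1)))
        (L.countP fun e => A * (n + 1) ≤ e + 1), (fun K => ∑ x ∈ Finset.range K,
          (((x : ℚ) + 1 - L.length) ^ e / (∏ j ∈ Finset.range (n + 1),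
            ((x : ℚ) + 1 + (L.length * n : ℕ) + j)) ^ A) * g x) ∈
        tailSpan A ((e :: L).length * n) (e :: L).length δ
          ((e :: L).countP fun e => A * (n + 1) ≤ e + 1) := by
      intro g hg
      induction hg using Submodule.span_induction with
      | mem g hg =>
        obtain ⟨f, d, s, hf, hd, hs, hA, hc, rfl⟩ := hg
        have h1 := sum_mul_harmonicSum_mem_tailSpan s hA
          (b := L.length * n + n) (hf.mul_monomial (n := n) (e := e) (t := L.length))
        have hb : (e :: L).length * n = L.length * n + n := by
          rw [List.length_cons, Nat.succ_mul]
        rw [hb]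
        simp only [mul_assoc] at h1 ⊢
        refine tailSpan_mono (by simpa using hs) (by lia) ?_ h1
        rw [List.countP_cons]
        simp only [decide_eq_true_eq]
        have hz : (A * (n + 1) : ℤ) = (A * (n + 1) : ℕ) := by push_cast; ring
        rw [hz]
        split_ifs at hc ⊢ <;> lia
      | zero =>
        simp only [Pi.zero_apply, mul_zero, Finset.sum_const_zero]
        exact Submodule.zero_mem _
      | add g₁ g₂ _ _ h₁ h₂ =>
        convert Submodule.add_mem _ h₁ h₂ using 1
        funext K
        simp only [Pi.add_apply, mul_add, Finset.sum_add_distrib]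
      | smul a g _ h =>
        convert Submodule.smul_mem _ a h using 1
        funext K
        simp only [Pi.smul_apply, smul_eq_mul, Finset.mul_sum]
        exact Finset.sum_congr rfl fun x _ => by ring
    exact key _ ih'

end TruncatedSums

section Limits

open Filter Topology

theorem nestedSum_ofFn {q : ℕ} (f : Fin q → ℕ → ℚ) (K : ℕ) :
    nestedSum (List.ofFn f) K = ∑ x ∈ Fintype.piFinset fun _ : Fin q => Finset.range K,
      {x : Fin q → ℕ | StrictAnti x}.indicator (fun x => ∏ i, f i (x i)) x := by
  classical
  simp only [Set.indicator_apply, Set.mem_ofPred_eq, ← Finset.sum_filter]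
  induction q generalizing K with
  | zero =>
    rw [List.ofFn_zero, nestedSum, Finset.filter_true_of_mem fun x _ => Subsingleton.strictAnti x]
    simp
  | succ q ih =>
    rw [List.ofFn_succ, nestedSum]
    simp only [ih, Finset.mul_sum]
    rw [Finset.sum_sigma']
    refine Finset.sum_bij' (fun y _ => Fin.cons y.1 y.2) (fun z _ => ⟨z 0, Fin.tail z⟩)
      ?_ ?_ ?_ ?_ ?_
    · rintro ⟨x, y⟩ h
      simp only [Finset.mem_sigma, Finset.mem_range, Finset.mem_filter, Fintype.mem_piFinset] at h ⊢
      obtain ⟨hx, hy, hanti⟩ := h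
      refine ⟨fun i => ?_, ?_⟩
      · refine Fin.cases ?_ (fun j => ?_) i
        · simpa using hx
        · simpa using (hy j).trans hx
      · intro i j hij
        induction j using Fin.cases with
        | zero => exact absurd hij (Fin.not_lt_zero i)
        | succ j =>
          induction i using Fin.cases with
          | zero => simpa using hy j
          | succ i => simpa using hanti (Fin.succ_lt_succ_iff.mp hij)
    · intro z h
      simp only [Finset.mem_sigma, Finset.mem_range, Finset.mem_filter, Fintype.mem_piFinset] at h ⊢
      exact ⟨h.1 0, fun i => h.2 (Fin.succ_pos i),
        fun i j hij => h.2 (Fin.succ_lt_succ_iff.mpr hij)⟩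
    · rintro ⟨x, y⟩ _
      simp
    · intro z _
      simp
    · rintro ⟨x, y⟩ _
      simp [Fin.prod_univ_succ]

/-- A multiple series with nonnegative terms converges as soon as its truncations do. -/
theorem hasSum_of_tendsto_nestedSum {q : ℕ} {f : Fin q → ℕ → ℚ} {v : ℝ}
    (hf : ∀ x : Fin q → ℕ, StrictAnti x → 0 ≤ ∏ i, f i (x i))
    (hv : Tendsto (fun K => (nestedSum (List.ofFn f) K : ℝ)) atTop (𝓝 v)) :
    HasSum (fun x : {x : Fin q → ℕ // StrictAnti x} => ((∏ i, f i (x.1 i) : ℚ) : ℝ)) v := by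
  classical
  set g : (Fin q → ℕ) → ℝ :=
    {x : Fin q → ℕ | StrictAnti x}.indicator fun x => ((∏ i, f i (x i) : ℚ) : ℝ) with hg
  have hg0 : 0 ≤ g := fun x => Set.indicator_apply_nonneg fun hx => Rat.cast_nonneg.mpr (hf x hx)
  have hsum : ∀ K, ∑ x ∈ Fintype.piFinset fun _ : Fin q => Finset.range K, g x =
      (nestedSum (List.ofFn f) K : ℝ) := by
    intro K
    rw [nestedSum_ofFn, Rat.cast_sum]
    refine Finset.sum_congr rfl fun x _ => ?_
    simp only [hg, Set.indicator_apply]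
    split_ifs <;> simp
  have hcover : Tendsto (fun K => Fintype.piFinset fun _ : Fin q => Finset.range K)
      atTop atTop := by
    refine Monotone.tendsto_atTop_finset (fun K K' h => ?_) fun x => ?_
    · exact Fintype.piFinset_subset _ _ fun _ => Finset.range_mono h
    · refine ⟨(∑ i, x i) + 1, Fintype.mem_piFinset.mpr fun i => Finset.mem_range.mpr ?_⟩
      exact Nat.lt_succ_of_le (Finset.single_le_sum (fun _ _ => Nat.zero_le _) (Finset.mem_univ i))
  obtain ⟨C, hC⟩ := hv.bddAbove_range
  have hsummable : Summable g := by
    refine summable_of_sum_le hg0 (c := C) fun u => ?_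
    obtain ⟨K, hK⟩ := (hcover.eventually_ge_atTop u).exists
    refine (Finset.sum_le_sum_of_subset_of_nonneg hK fun x _ _ => hg0 x).trans ?_
    rw [hsum]
    exact hC ⟨K, rfl⟩
  have hlim := hsummable.hasSum.comp hcover
  have heq : ∑' x, g x = v := by
    refine tendsto_nhds_unique hlim ?_
    simpa only [Function.comp_def, hsum] using hv
  have hgv : HasSum g v := heq ▸ hsummable.hasSum
  have hsub := (Function.Injective.hasSum_iff
    (Subtype.val_injective (p := fun x : Fin q → ℕ => StrictAnti x)) fun x hx =>
      Set.indicator_of_notMem (fun h => hx ⟨⟨x, h⟩, rfl⟩) _).mpr hgv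
  exact hsub.congr_fun fun x => (Set.indicator_of_mem (s := {x : Fin q → ℕ | StrictAnti x}) x.2
    fun x => ((∏ i, f i (x i) : ℚ) : ℝ)).symm

theorem invPow_nonneg (a x : ℕ) : 0 ≤ invPow a x := by
  unfold invPow
  positivity

theorem harmonicSum_nonneg (s : List ℕ) (K : ℕ) : 0 ≤ harmonicSum s K := by
  induction s generalizing K with
  | nil => simp [harmonicSum_nil]
  | cons a s ih => exact Finset.sum_nonneg fun x _ => mul_nonneg (invPow_nonneg a x) (ih x)

theorem harmonicSum_le_harmonic_pow {s : List ℕ} (hs : ∀ a ∈ s, 1 ≤ a) (K : ℕ) :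
    harmonicSum s K ≤ harmonic K ^ s.length := by
  induction s generalizing K with
  | nil => simp [harmonicSum_nil]
  | cons a s ih =>
    rw [harmonicSum_cons, List.length_cons, pow_succ', harmonic, Finset.sum_mul]
    refine Finset.sum_le_sum fun x hx => mul_le_mul ?_ ((ih (fun a h => hs a (by simp [h])) x).trans
      ?_) (harmonicSum_nonneg s x) (by positivity)
    · rw [invPow]
      push_cast
      refine inv_anti₀ (by positivity) (le_self_pow₀ ?_ ?_)
      · linarith [(Nat.cast_nonneg x : (0 : ℚ) ≤ x)]
      · have := hs a (by simp)
        lia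
    · unfold harmonic
      refine pow_le_pow_left₀ (Finset.sum_nonneg fun _ _ => by positivity)
        (Finset.sum_le_sum_of_subset_of_nonneg ?_ fun _ _ _ => by positivity) _
      exact Finset.range_mono (Finset.mem_range.mp hx).le

theorem exists_harmonicSum_le_sqrt {s : List ℕ} (hs : ∀ a ∈ s, 1 ≤ a) :
    ∃ C : ℝ, 0 ≤ C ∧ ∀ K : ℕ, (harmonicSum s K : ℝ) ≤ C * ((K : ℝ) + 1) ^ (1 / 2 : ℝ) := by
  set m := s.length with hm
  set ε : ℝ := 1 / (2 * (m + 1)) with hε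
  have hε0 : 0 < ε := by positivity
  refine ⟨(1 + 1 / ε) ^ m, by positivity, fun K => ?_⟩
  have hK1 : (1 : ℝ) ≤ (K : ℝ) + 1 := by linarith [(Nat.cast_nonneg K : (0 : ℝ) ≤ K)]
  have hharm : (harmonic K : ℝ) ≤ (1 + 1 / ε) * ((K : ℝ) + 1) ^ ε := by
    have h1 : Real.log K ≤ Real.log (K + 1) := by
      rcases Nat.eq_zero_or_pos K with rfl | hK
      · simp
      · exact Real.log_le_log (by exact_mod_cast hK) (by linarith)
    have h2 := Real.log_le_rpow_div (x := (K : ℝ) + 1) (by positivity) hε0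
    have h3 := Real.one_le_rpow hK1 hε0.le
    have h4 := harmonic_le_one_add_log K
    have h5 : (1 + 1 / ε) * ((K : ℝ) + 1) ^ ε = ((K : ℝ) + 1) ^ ε + ((K : ℝ) + 1) ^ ε / ε := by ring
    linarith
  have hharm0 : (0 : ℝ) ≤ (harmonic K : ℝ) := by
    have : 0 ≤ harmonic K := Finset.sum_nonneg fun _ _ => by positivity
    exact_mod_cast this
  calc (harmonicSum s K : ℝ) ≤ (harmonic K : ℝ) ^ m := by
        exact_mod_cast harmonicSum_le_harmonic_pow hs K
    _ ≤ ((1 + 1 / ε) * ((K : ℝ) + 1) ^ ε) ^ m := pow_le_pow_left₀ hharm0 hharm m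
    _ = (1 + 1 / ε) ^ m * ((K : ℝ) + 1) ^ (ε * m) := by
        rw [mul_pow, Real.rpow_mul_natCast (by positivity)]
    _ ≤ _ := by
        refine mul_le_mul_of_nonneg_left (Real.rpow_le_rpow_of_exponent_le hK1 ?_) (by positivity)
        rw [hε, div_mul_eq_mul_div, one_mul, div_le_div_iff₀ (by positivity) (by positivity)]
        linarith

theorem IsRat.exists_abs_le {A b : ℕ} {f : ℕ → ℚ} (hf : IsRat A b (-1) f) :
    ∃ C : ℝ, ∀ K : ℕ, |(f K : ℝ)| ≤ C * ((K : ℝ) + 1)⁻¹ := by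
  obtain ⟨P, hP, hf⟩ := hf
  rcases eq_or_ne P 0 with rfl | hP0
  · exact ⟨0, fun K => by simp [hf]⟩
  have hdeg : P.natDegree + 1 ≤ A * b := by
    have := hP.natDegree_le hP0
    have h2 : (P.natDegree + 1 : ℤ) ≤ (A * b : ℕ) := by
      push_cast
      lia
    exact_mod_cast h2
  refine ⟨((∑ i ∈ Finset.range (P.natDegree + 1), |P.coeff i| : ℚ) : ℝ), fun K => ?_⟩
  have hK1 : (1 : ℚ) ≤ (K : ℚ) + 1 := by linarith [(Nat.cast_nonneg K : (0 : ℚ) ≤ K)]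
  have hnum : |P.eval (K : ℚ)| ≤
      (∑ i ∈ Finset.range (P.natDegree + 1), |P.coeff i|) * ((K : ℚ) + 1) ^ P.natDegree := by
    rw [Polynomial.eval_eq_sum_range, Finset.sum_mul]
    refine (Finset.abs_sum_le_sum_abs _ _).trans (Finset.sum_le_sum fun i hi => ?_)
    rw [abs_mul, abs_of_nonneg (by positivity : (0 : ℚ) ≤ (K : ℚ) ^ i)]
    refine mul_le_mul_of_nonneg_left ?_ (abs_nonneg _)
    exact (pow_le_pow_left₀ (by positivity) (by linarith) i).trans
      (pow_le_pow_right₀ hK1 (Nat.lt_succ_iff.mp (Finset.mem_range.mp hi)))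
  have hden : ((K : ℚ) + 1) ^ (P.natDegree + 1) ≤ (polePoly A b).eval (K : ℚ) := by
    refine (pow_le_pow_right₀ hK1 hdeg).trans ?_
    rw [eval_polePoly, pow_mul, Finset.prod_pow, ← pow_mul, mul_comm A b, pow_mul]
    refine pow_le_pow_left₀ (by positivity) ?_ A
    calc ((K : ℚ) + 1) ^ b = ∏ _j ∈ Finset.range b, ((K : ℚ) + 1) := by simp
      _ ≤ _ := Finset.prod_le_prod (fun _ _ => by positivity) fun j _ => by
        linarith [(Nat.cast_nonneg j : (0 : ℚ) ≤ j)]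
  have hQ : |f K| ≤ (∑ i ∈ Finset.range (P.natDegree + 1), |P.coeff i|) * ((K : ℚ) + 1)⁻¹ := by
    rw [hf, abs_div, abs_of_pos (eval_polePoly_pos A b K), div_le_iff₀ (eval_polePoly_pos A b K)]
    refine hnum.trans ?_
    rw [mul_assoc]
    refine mul_le_mul_of_nonneg_left ?_ (Finset.sum_nonneg fun _ _ => abs_nonneg _)
    rw [inv_mul_eq_div, le_div_iff₀ (by positivity), ← pow_succ]
    exact hden
  have hcast := (Rat.cast_le (K := ℝ)).mpr hQ
  rw [Rat.cast_mul] at hcast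
  simpa only [Rat.cast_abs, Rat.cast_inv, Rat.cast_add, Rat.cast_natCast, Rat.cast_one] using hcast

theorem IsRat.tendsto_mul_harmonicSum {A b : ℕ} {f : ℕ → ℚ} (hf : IsRat A b (-1) f) {s : List ℕ}
    (hs : ∀ a ∈ s, 1 ≤ a) :
    Tendsto (fun K => ((f K * harmonicSum s K : ℚ) : ℝ)) atTop (𝓝 0) := by
  obtain ⟨C, hC⟩ := hf.exists_abs_le
  obtain ⟨C', hC'0, hC'⟩ := exists_harmonicSum_le_sqrt hs
  have hC0 : 0 ≤ C := by simpa using (abs_nonneg _).trans (hC 0)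
  have hlim : Tendsto (fun K : ℕ => C * C' * ((K : ℝ) + 1) ^ (-(1 / 2) : ℝ)) atTop (𝓝 0) := by
    rw [← mul_zero (C * C')]
    refine Tendsto.const_mul _ ((tendsto_rpow_neg_atTop (by norm_num)).comp ?_)
    exact tendsto_atTop_add_const_right _ _ tendsto_natCast_atTop_atTop
  refine squeeze_zero_norm (fun K => ?_) hlim
  have hK : (0 : ℝ) < (K : ℝ) + 1 := by positivity
  have hpow : ((K : ℝ) + 1)⁻¹ * ((K : ℝ) + 1) ^ (1 / 2 : ℝ) = ((K : ℝ) + 1) ^ (-(1 / 2) : ℝ) := by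
    rw [← Real.rpow_neg_one, ← Real.rpow_add hK]
    norm_num
  rw [Rat.cast_mul, Real.norm_eq_abs, abs_mul,
    abs_of_nonneg (by exact_mod_cast harmonicSum_nonneg s K : (0 : ℝ) ≤ harmonicSum s K)]
  calc _ ≤ (C * ((K : ℝ) + 1)⁻¹) * (C' * ((K : ℝ) + 1) ^ (1 / 2 : ℝ)) :=
        mul_le_mul (hC K) (hC' K) (by exact_mod_cast harmonicSum_nonneg s K) (by positivity)
    _ = _ := by rw [← hpow]; ring

/-- The truncations of a convergent multiple zeta value converge to it. -/
theorem tendsto_harmonicSum_mzv {s : List ℕ} (hs : ∀ a ∈ s, 1 ≤ a) (hs2 : s ≠ [] → 2 ≤ s.headI) :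
    Tendsto (fun K => (harmonicSum s K : ℝ)) atTop (𝓝 (mzv s)) := by
  have hconv : ∃ v, Tendsto (fun K => (harmonicSum s K : ℝ)) atTop (𝓝 v) := by
    cases s with
    | nil => exact ⟨1, by simp [harmonicSum_nil]⟩
    | cons a s =>
      obtain ⟨C, hC0, hC⟩ := exists_harmonicSum_le_sqrt (s := s) fun a h => hs a (by simp [h])
      have ha : 2 ≤ a := hs2 (by simp)
      have hsum : Summable fun x : ℕ => ((invPow a x * harmonicSum s x : ℚ) : ℝ) := by
        have h32 : Summable fun x : ℕ => C * ((x : ℝ) + 1) ^ (-(3 / 2) : ℝ) := by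
          refine Summable.mul_left _ ?_
          have := (summable_nat_add_iff 1).mpr
            (Real.summable_nat_rpow (p := -(3 / 2)) |>.mpr (by norm_num))
          simpa using this
        refine h32.of_nonneg_of_le (fun x => ?_) fun x => ?_
        · exact_mod_cast mul_nonneg (invPow_nonneg a x) (harmonicSum_nonneg s x)
        · have hx : (0 : ℝ) < (x : ℝ) + 1 := by positivity
          have hx1 : (1 : ℝ) ≤ (x : ℝ) + 1 := by linarith [(Nat.cast_nonneg x : (0 : ℝ) ≤ x)]
          have h1 : (invPow a x : ℝ) ≤ ((x : ℝ) + 1) ^ (-2 : ℝ) := by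
            rw [Real.rpow_neg hx.le, invPow]
            push_cast
            refine inv_anti₀ (by positivity) ?_
            rw [show (2 : ℝ) = (2 : ℕ) by norm_num, Real.rpow_natCast]
            exact pow_le_pow_right₀ hx1 ha
          rw [Rat.cast_mul]
          calc _ ≤ ((x : ℝ) + 1) ^ (-2 : ℝ) * (C * ((x : ℝ) + 1) ^ (1 / 2 : ℝ)) :=
                mul_le_mul h1 (hC x) (by exact_mod_cast harmonicSum_nonneg s x) (by positivity)
            _ = C * (((x : ℝ) + 1) ^ (-2 : ℝ) * ((x : ℝ) + 1) ^ (1 / 2 : ℝ)) := by ring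
            _ = _ := by
              rw [← Real.rpow_add hx]
              norm_num
      refine ⟨_, hsum.hasSum.tendsto_sum_nat.congr fun K => ?_⟩
      rw [harmonicSum_cons, Rat.cast_sum]
  obtain ⟨v, hv⟩ := hconv
  have hof : List.ofFn (fun i : Fin s.length => invPow (s.get i)) = s.map invPow := by
    simp only [List.get_eq_getElem]
    exact List.ofFn_getElem_eq_map s invPow
  have hsum := hasSum_of_tendsto_nestedSum (f := fun i : Fin s.length => invPow (s.get i))
    (fun x _ => Finset.prod_nonneg fun i _ => invPow_nonneg _ _) (by rw [hof]; exact hv)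
  let e : {x : Fin s.length → ℕ // StrictAnti x} ≃
      {k : Fin s.length → ℕ // StrictAnti k ∧ ∀ i, 1 ≤ k i} :=
    { toFun := fun x => ⟨fun i => x.1 i + 1, fun i j h => Nat.add_lt_add_right (x.2 h) 1,
        fun i => by lia⟩
      invFun := fun k => ⟨fun i => k.1 i - 1, fun i j h => by
        have := k.2.1 h
        have := k.2.2 j
        dsimp only
        lia⟩
      left_inv := fun x => by simp
      right_inv := fun k => by
        ext i
        have := k.2.2 i
        simp only
        lia }
  have hmzv : mzv s = v := by
    rw [mzv, ← e.tsum_eq, ← hsum.tsum_eq]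
    refine tsum_congr fun x => ?_
    simp [e, invPow]
  rw [hmzv]
  exact hv

/-- The span of the convergent multiple zeta values of depth at most `q` whose exponents are at
most `A`, at most `u` of them being equal to one. -/
noncomputable def mzvSpan (A q u : ℕ) : Submodule ℚ ℝ :=
  Submodule.span ℚ (mzv '' {s | s.length ≤ q ∧ (s ≠ [] → 2 ≤ s.headI) ∧
    (∀ a ∈ s, 1 ≤ a ∧ a ≤ A) ∧ s.count 1 ≤ u})

theorem mzvSpan_mono {A q q' u u' : ℕ} (hq : q ≤ q') (hu : u ≤ u') :
    mzvSpan A q u ≤ mzvSpan A q' u' :=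
  Submodule.span_mono (Set.image_mono fun _ ⟨h1, h2, h3, h4⟩ => ⟨h1.trans hq, h2, h3, h4.trans hu⟩)

/-- The sequences with a limit in `mzvSpan A q u`. -/
def mzvLimits (A q u : ℕ) : Submodule ℚ (ℕ → ℚ) where
  carrier := {g | ∃ v ∈ mzvSpan A q u, Tendsto (fun K => (g K : ℝ)) atTop (𝓝 v)}
  zero_mem' := ⟨0, Submodule.zero_mem _, by simp⟩
  add_mem' := by
    rintro g h ⟨v, hv, hg⟩ ⟨w, hw, hh⟩
    exact ⟨v + w, Submodule.add_mem _ hv hw, by simpa using hg.add hh⟩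
  smul_mem' := by
    rintro a g ⟨v, hv, hg⟩
    refine ⟨a • v, Submodule.smul_mem _ a hv, ?_⟩
    simpa [Rat.smul_def] using hg.const_mul (a : ℝ)

theorem mzvLimits_mono {A q q' u u' : ℕ} (hq : q ≤ q') (hu : u ≤ u') :
    mzvLimits A q u ≤ mzvLimits A q' u' :=
  fun _ ⟨v, hv, hg⟩ => ⟨v, mzvSpan_mono hq hu hv, hg⟩

theorem const_mul_harmonicSum_mem_mzvLimits {A q u : ℕ} {s : List ℕ} (c : ℚ) (hq : s.length ≤ q)
    (hs2 : s ≠ [] → 2 ≤ s.headI) (hs : ∀ a ∈ s, 1 ≤ a ∧ a ≤ A) (hu : s.count 1 ≤ u) :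
    (fun K => c * harmonicSum s K) ∈ mzvLimits A q u :=
  Submodule.smul_mem (mzvLimits A q u) c ⟨mzv s, Submodule.subset_span ⟨s, ⟨hq, hs2, hs, hu⟩, rfl⟩,
    tendsto_harmonicSum_mzv (fun a ha => (hs a ha).1) hs2⟩

theorem IsRat.mul_harmonicSum_mem_mzvLimits {A b q u : ℕ} {f : ℕ → ℚ} (hf : IsRat A b (-1) f)
    {s : List ℕ} (hs : ∀ a ∈ s, 1 ≤ a ∧ a ≤ A) :
    (fun K => f K * harmonicSum s K) ∈ mzvLimits A q u :=
  ⟨0, Submodule.zero_mem _, hf.tendsto_mul_harmonicSum fun a ha => (hs a ha).1⟩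

theorem sum_mul_harmonicSum_mem_mzvLimits {A b : ℕ} (s : List ℕ) (hs : ∀ a ∈ s, 1 ≤ a ∧ a ≤ A)
    {f : ℕ → ℚ} (hf : IsRat A (b + 1) (-2) f) :
    (fun K => ∑ x ∈ Finset.range K, f x * harmonicSum s x) ∈
      mzvLimits A (s.length + 1) (s.count 1) := by
  induction s generalizing f with
  | nil =>
    obtain ⟨c, F, hF, hc, hfx⟩ := hf.exists_reduction le_rfl
    rw [if_neg (by norm_num)] at hF
    have hsum : (fun K => ∑ x ∈ Finset.range K, f x * harmonicSum [] x) =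
        (∑ σ ∈ Finset.Icc 1 A, fun K => c σ * harmonicSum [σ] K) +
          ((fun K => F K * harmonicSum [] K) + fun K => -F 0 * harmonicSum [] K) := by
      funext K
      rw [sum_range_mul_of_reduction hfx, sum_range_sub_nil]
      simp only [Pi.add_apply, Finset.sum_apply, harmonicSum_nil]
      ring
    rw [hsum]
    refine Submodule.add_mem _ (Submodule.sum_mem _ fun σ hσ => ?_) (Submodule.add_mem _ ?_ ?_)
    · rw [Finset.mem_Icc] at hσ
      by_cases h1 : σ = 1
      · rw [h1, hc le_rfl]
        simp only [zero_mul]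
        exact Submodule.zero_mem _
      · refine const_mul_harmonicSum_mem_mzvLimits _ (by simp) (fun _ => ?_) (by simpa using hσ) ?_
        · simp only [List.headI_cons]
          lia
        · rw [List.count_singleton]
          simp [h1]
    · exact hF.mul_harmonicSum_mem_mzvLimits (by simp)
    · exact const_mul_harmonicSum_mem_mzvLimits _ (by simp) (by simp) (by simp) (by simp)
  | cons a s ih =>
    obtain ⟨c, F, hF, hc, hfx⟩ := hf.exists_reduction le_rfl
    rw [if_neg (by norm_num)] at hF
    have hsum : (fun K => ∑ x ∈ Finset.range K, f x * harmonicSum (a :: s) x) =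
        (∑ σ ∈ Finset.Icc 1 A, fun K => c σ * harmonicSum (σ :: a :: s) K) +
          ((fun K => F K * harmonicSum (a :: s) K) - fun K => ∑ x ∈ Finset.range K,
            (((x + 1 : ℚ) ^ a)⁻¹ * F (x + 1)) * harmonicSum s x) := by
      funext K
      rw [sum_range_mul_of_reduction hfx, sum_range_sub_cons]
      simp only [Pi.add_apply, Pi.sub_apply, Finset.sum_apply]
    have ha := hs a (by simp)
    have hs' : ∀ a ∈ s, 1 ≤ a ∧ a ≤ A := fun a h => hs a (by simp [h])
    rw [hsum]
    refine Submodule.add_mem _ (Submodule.sum_mem _ fun σ hσ => ?_) (Submodule.sub_mem _ ?_ ?_)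
    · rw [Finset.mem_Icc] at hσ
      by_cases h1 : σ = 1
      · rw [h1, hc le_rfl]
        simp only [zero_mul]
        exact Submodule.zero_mem _
      · refine const_mul_harmonicSum_mem_mzvLimits _ (by simp) (fun _ => ?_) ?_ ?_
        · simp only [List.headI_cons]
          lia
        · intro x hx
          rcases List.mem_cons.mp hx with rfl | hx
          · exact hσ
          · exact hs x hx
        · rw [List.count_cons (a := 1) (b := σ)]
          simp [h1]
    · exact hF.mul_harmonicSum_mem_mzvLimits hs
    · exact mzvLimits_mono (by simp) List.count_le_count_cons
        (ih hs' ((hF.shift_mul_inv_pow ha.2).mono (by lia)))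

theorem nestedSum_monomialFactors_mem_mzvLimits {A n : ℕ} (L : List ℕ) (hL : L ≠ [])
    (h9 : ∀ j < L.length,
      ((L.take (j + 1)).map fun e : ℕ => (e + 1 - A * (n + 1) : ℤ)).sum ≤ -1) :
    nestedSum (monomialFactors A n L) ∈
      mzvLimits A L.length (L.countP fun e => A * (n + 1) ≤ e + 1) := by
  obtain ⟨e, L, rfl⟩ := List.exists_cons_of_ne_nil hL
  have hmem := nestedSum_monomialFactors_mem_tailSpan (A := A) (n := n) L
    (δ := -1 - (e + 1 - A * (n + 1))) fun j hj => by
      have := h9 j (by simpa [Nat.lt_succ_iff] using hj)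
      simp only [List.take_succ_cons, List.map_cons, List.sum_cons] at this
      lia
  have he : ¬ A * (n + 1) ≤ e + 1 := by
    have := h9 0 (by simp)
    simp only [zero_add, List.take_succ_cons, List.take_zero, List.map_cons, List.map_nil,
      List.sum_cons, List.sum_nil, add_zero] at this
    have hz : (A * (n + 1) : ℤ) = (A * (n + 1) : ℕ) := by push_cast; ring
    lia
  have key : ∀ g ∈ tailSpan A (L.length * n) L.length (-1 - (e + 1 - A * (n + 1)))
      (L.countP fun e => A * (n + 1) ≤ e + 1), (fun K => ∑ x ∈ Finset.range K,
        (((x : ℚ) + 1 - L.length) ^ e / (∏ j ∈ Finset.range (n + 1),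
          ((x : ℚ) + 1 + (L.length * n : ℕ) + j)) ^ A) * g x) ∈
      mzvLimits A (e :: L).length ((e :: L).countP fun e => A * (n + 1) ≤ e + 1) := by
    intro g hg
    induction hg using Submodule.span_induction with
    | mem g hg =>
      obtain ⟨f, d, s, hf, hd, hs, hA, hc, rfl⟩ := hg
      have h1 := sum_mul_harmonicSum_mem_mzvLimits s hA (b := L.length * n + n)
        ((hf.mul_monomial (n := n) (e := e) (t := L.length)).mono (by lia))
      simp only [mul_assoc] at h1 ⊢
      refine mzvLimits_mono (by simpa using hs) ?_ h1
      rw [List.countP_cons_of_neg (by simpa using he)]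
      lia
    | zero =>
      simp only [Pi.zero_apply, mul_zero, Finset.sum_const_zero]
      exact Submodule.zero_mem _
    | add g₁ g₂ _ _ h₁ h₂ =>
      convert Submodule.add_mem _ h₁ h₂ using 1
      funext K
      simp only [Pi.add_apply, mul_add, Finset.sum_add_distrib]
    | smul a g _ h =>
      convert Submodule.smul_mem _ a h using 1
      funext K
      simp only [Pi.smul_apply, smul_eq_mul, Finset.mul_sum]
      exact Finset.sum_congr rfl fun x _ => by ring
  exact key _ hmem

end Limits

section MonomialSeries

theorem monomialFactors_ofFn (A n : ℕ) {p : ℕ} (m : Fin p → ℕ) :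
    monomialFactors A n (List.ofFn m) = List.ofFn fun (i : Fin p) (x : ℕ) =>
      ((x : ℚ) + 1 - (p - 1 - i : ℕ)) ^ m i /
        (∏ j ∈ Finset.range (n + 1), ((x : ℚ) + 1 + ((p - 1 - i) * n : ℕ) + j)) ^ A := by
  induction p with
  | zero => simp [monomialFactors]
  | succ p ih =>
    rw [List.ofFn_succ, List.ofFn_succ, monomialFactors, ih, List.length_ofFn]
    congr 2
    funext i
    rw [Fin.val_succ, show p + 1 - 1 - (i.1 + 1) = p - 1 - i by lia]

theorem countP_ofFn (t : ℕ) {p : ℕ} (m : Fin p → ℕ) :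
    (List.ofFn m).countP (fun e => t ≤ e + 1) =
      (Finset.univ.filter fun i : Fin p => t ≤ m i + 1).card := by
  induction p with
  | zero => simp
  | succ p ih =>
    rw [List.ofFn_succ, List.countP_cons, ih, Fin.card_filter_univ_succ]
    simp only [decide_eq_true_eq]
    split_ifs <;> rfl

theorem ascPochhammer_eval_eq_prod_range {R : Type*} [CommSemiring R] (n : ℕ) (r : R) :
    (ascPochhammer R n).eval r = ∏ j ∈ Finset.range n, (r + j) := by
  induction n with
  | zero => simp
  | succ n ih => rw [ascPochhammer_succ_eval, ih, Finset.prod_range_succ]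

theorem StrictAnti.add_sub_le {p : ℕ} {x : Fin p → ℕ} (hx : StrictAnti x) {i j : Fin p}
    (hij : i ≤ j) : x j + (j - i : ℕ) ≤ x i := by
  obtain ⟨j, hj⟩ := j
  induction j with
  | zero =>
    have : i = ⟨0, hj⟩ := Fin.ext (Nat.le_zero.mp hij)
    simp [this]
  | succ j ih =>
    rcases eq_or_lt_of_le hij with rfl | hlt
    · simp
    · have hle : i ≤ ⟨j, by lia⟩ := Nat.lt_succ_iff.mp hlt
      have h1 := ih (by lia) hle
      have h2 : x ⟨j + 1, hj⟩ < x ⟨j, by lia⟩ := hx (Nat.lt_succ_self j)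
      have h3 : i.1 ≤ j := hle
      dsimp only at h1 ⊢
      lia

theorem StrictAnti.sub_le {p : ℕ} {x : Fin p → ℕ} (hx : StrictAnti x) (i : Fin p) :
    p - 1 - i ≤ x i := by
  have h := hx.add_sub_le (j := ⟨p - 1, Nat.sub_one_lt_of_lt i.2⟩) (i := i)
    (Nat.le_sub_one_of_lt i.2)
  exact (Nat.le_add_left _ _).trans h

/-- Strictly decreasing tuples correspond to weakly decreasing tuples of positive integers. -/
def strictAntiEquiv (p : ℕ) : {x : Fin p → ℕ // StrictAnti x} ≃
    {k : Fin p → ℕ // Antitone k ∧ ∀ i, 1 ≤ k i} where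
  toFun x := ⟨fun i => x.1 i + 1 - (p - 1 - i), fun i j hij => by
    have h1 := x.2.add_sub_le hij
    have h2 := x.2.sub_le j
    have h3 : i.1 ≤ j.1 := hij
    dsimp only
    lia, fun i => by
    have := x.2.sub_le i
    lia⟩
  invFun k := ⟨fun i => k.1 i - 1 + (p - 1 - i), fun i j hij => by
    have h1 := k.2.1 hij.le
    have h3 : i.1 < j.1 := hij
    dsimp only
    lia⟩
  left_inv x := by
    ext i
    have := x.2.sub_le i
    dsimp only
    lia
  right_inv k := by
    ext i
    have := k.2.2 i
    dsimp only
    lia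

theorem exists_hasSum_monomial {p : ℕ} (hp : 0 < p) (A n : ℕ) (m : Fin p → ℕ)
    (h9 : ∀ j : Fin p, (∑ i ∈ Finset.Iic j, m i) + j.1 + 2 ≤ (j.1 + 1) * (A * (n + 1))) :
    ∃ v ∈ mzvSpan A p (Finset.univ.filter fun i : Fin p => A * (n + 1) ≤ m i + 1).card,
      HasSum (fun k : {k : Fin p → ℕ // Antitone k ∧ ∀ i, 1 ≤ k i} =>
        (∏ i, (k.1 i : ℝ) ^ m i) / ∏ i : Fin p, ((ascPochhammer ℝ (n + 1)).eval
          ((k.1 i : ℝ) + ((p - 1 - i.1) * (n + 1) : ℕ))) ^ A) v := by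
  obtain ⟨v, hv, hlim⟩ := nestedSum_monomialFactors_mem_mzvLimits (A := A) (n := n) (List.ofFn m)
    (by
      rw [← List.length_pos_iff, List.length_ofFn]
      exact hp) (fun j hj => by
      rw [List.length_ofFn] at hj
      have h := h9 ⟨j, hj⟩
      have hset : (Finset.univ.filter fun i : Fin p => i.1 < j + 1) = Finset.Iic ⟨j, hj⟩ := by
        ext i
        simp [Fin.le_def]
      rw [List.map_take, List.map_ofFn, List.sum_take_ofFn, hset]
      simp only [Function.comp_apply, Finset.sum_sub_distrib, Finset.sum_add_distrib,
        Finset.sum_const, Fin.card_Iic, nsmul_eq_mul, mul_one]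
      zify at h
      push_cast
      lia)
  rw [List.length_ofFn, countP_ofFn] at hv
  rw [monomialFactors_ofFn] at hlim
  refine ⟨v, hv, (strictAntiEquiv p).hasSum_iff.mp ?_⟩
  refine (hasSum_of_tendsto_nestedSum (fun x hx => ?_) hlim).congr_fun fun x => ?_
  · refine Finset.prod_nonneg fun i _ => ?_
    have h1 : ((p - 1 - i : ℕ) : ℚ) ≤ x i := by exact_mod_cast hx.sub_le i
    exact div_nonneg (pow_nonneg (by linarith) _)
      (pow_nonneg (Finset.prod_nonneg fun _ _ => by positivity) _)
  · rw [Finset.prod_div_distrib, Rat.cast_div, Rat.cast_prod, Rat.cast_prod]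
    have hcast : ∀ i, (((strictAntiEquiv p x).1 i : ℕ) : ℝ) =
        (x.1 i : ℝ) + 1 - (p - 1 - i : ℕ) := by
      intro i
      have h := x.2.sub_le i
      change ((x.1 i + 1 - (p - 1 - i) : ℕ) : ℝ) = _
      rw [Nat.cast_sub (by lia), Nat.cast_add_one]
    simp only [Function.comp_apply, hcast]
    congr 1
    · refine Finset.prod_congr rfl fun i _ => ?_
      push_cast
      rfl
    · refine Finset.prod_congr rfl fun i _ => ?_
      rw [ascPochhammer_eval_eq_prod_range, Rat.cast_pow, Rat.cast_prod]
      congr 1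
      refine Finset.prod_congr rfl fun j _ => ?_
      push_cast
      ring

theorem exists_hasSum_mem_mzvSpan {p : ℕ} (hp : 0 < p) (A n : ℕ) (P : MvPolynomial (Fin p) ℚ)
    (h9 : ∀ j : Fin p, (∑ i ∈ Finset.Iic j, P.degreeOf i) + j.1 + 2 ≤
      (j.1 + 1) * (A * (n + 1))) :
    ∃ v ∈ mzvSpan A p (Finset.univ.filter
        (fun i : Fin p => A * (n + 1) ≤ P.degreeOf i + 1)).card,
      HasSum (fun k : {k : Fin p → ℕ // Antitone k ∧ ∀ i, 1 ≤ k i} =>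
        ((MvPolynomial.eval (fun i => (k.1 i : ℚ)) P : ℚ) : ℝ) /
          ∏ i : Fin p, ((ascPochhammer ℝ (n + 1)).eval
            ((k.1 i : ℝ) + ((p - 1 - i.1) * (n + 1) : ℕ))) ^ A) v := by
  have hdeg : ∀ m ∈ P.support, ∀ i, m i ≤ P.degreeOf i := fun m hm i =>
    MvPolynomial.monomial_le_degreeOf i hm
  choose! v hv hsum using fun (m : Fin p →₀ ℕ) (hm : m ∈ P.support) =>
    exists_hasSum_monomial hp A n m fun j =>
      le_trans (by gcongr with i; exact hdeg m hm i) (h9 j)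
  refine ⟨∑ m ∈ P.support, (P.coeff m : ℚ) • v m, Submodule.sum_mem _ fun m hm =>
    Submodule.smul_mem _ _ (mzvSpan_mono le_rfl (Finset.card_le_card ?_) (hv m hm)), ?_⟩
  · intro i hi
    simp only [Finset.mem_filter, Finset.mem_univ, true_and] at hi ⊢
    have := hdeg m hm i
    lia
  · simp only [Rat.smul_def]
    refine (hasSum_sum fun m hm => (hsum m hm).mul_left ((P.coeff m : ℚ) : ℝ)).congr_fun fun k => ?_
    rw [MvPolynomial.eval_eq', Rat.cast_sum, Finset.sum_div]
    refine Finset.sum_congr rfl fun m _ => ?_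
    push_cast
    rw [mul_div_assoc]

theorem exists_finset_of_mem_mzvSpan {A q u : ℕ} {v : ℝ} (hv : v ∈ mzvSpan A q u) :
    ∃ (T : Finset (List ℕ)) (c : List ℕ → ℚ),
      (∀ s ∈ T, s.length ≤ q ∧ (s ≠ [] → 2 ≤ s.headI) ∧ (∀ a ∈ s, 1 ≤ a ∧ a ≤ A) ∧
        s.count 1 ≤ u) ∧ v = ∑ s ∈ T, (c s : ℝ) * mzv s := by
  obtain ⟨l, hl, rfl⟩ := (Finsupp.mem_span_image_iff_linearCombination ℚ).mp hv
  refine ⟨l.support, l, fun s hs => hl hs, ?_⟩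
  rw [Finsupp.linearCombination_apply, Finsupp.sum]
  simp only [Rat.smul_def]

end MonomialSeries

theorem statement4 (p : ℕ) (hp : 0 < p) (A n : ℕ) (P : MvPolynomial (Fin p) ℚ)
    (h9 : ∀ j : Fin p, (∑ i ∈ Finset.Iic j, P.degreeOf i) + j.1 + 2 ≤
      (j.1 + 1) * (A * (n + 1))) :
    (Summable (fun k : {k : Fin p → ℕ // Antitone k ∧ ∀ i, 1 ≤ k i} =>
        ((MvPolynomial.eval (fun i => (k.1 i : ℚ)) P : ℚ) : ℝ) /
          ∏ i : Fin p,
            ((ascPochhammer ℝ (n + 1)).eval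
              ((k.1 i : ℝ) + ((p - 1 - i.1) * (n + 1) : ℕ))) ^ A) ∧
      ∃ (T : Finset (List ℕ)) (c : List ℕ → ℚ),
        (∀ s ∈ T, s.length ≤ p ∧ (s ≠ [] → 2 ≤ s.headI) ∧ (∀ a ∈ s, 1 ≤ a ∧ a ≤ A) ∧
          s.count 1 ≤ (Finset.univ.filter
            (fun i : Fin p => A * (n + 1) ≤ P.degreeOf i + 1)).card) ∧
        (∑' k : {k : Fin p → ℕ // Antitone k ∧ ∀ i, 1 ≤ k i},
            ((MvPolynomial.eval (fun i => (k.1 i : ℚ)) P : ℚ) : ℝ) /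
              ∏ i : Fin p,
                ((ascPochhammer ℝ (n + 1)).eval
                  ((k.1 i : ℝ) + ((p - 1 - i.1) * (n + 1) : ℕ))) ^ A)
          = ∑ s ∈ T, (c s : ℝ) * mzv s) ∧
    ((∀ i : Fin p, P.degreeOf i + 2 ≤ A * (n + 1)) →
      ∃ (T : Finset (List ℕ)) (c : List ℕ → ℚ),
        (∀ s ∈ T, s.length ≤ p ∧ ∀ a ∈ s, 2 ≤ a ∧ a ≤ A) ∧
        (∑' k : {k : Fin p → ℕ // Antitone k ∧ ∀ i, 1 ≤ k i},
            ((MvPolynomial.eval (fun i => (k.1 i : ℚ)) P : ℚ) : ℝ) /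
              ∏ i : Fin p,
                ((ascPochhammer ℝ (n + 1)).eval
                  ((k.1 i : ℝ) + ((p - 1 - i.1) * (n + 1) : ℕ))) ^ A)
          = ∑ s ∈ T, (c s : ℝ) * mzv s) := by
  obtain ⟨v, hv, hsum⟩ := exists_hasSum_mem_mzvSpan hp A n P h9
  obtain ⟨T, c, hT, rfl⟩ := exists_finset_of_mem_mzvSpan hv
  refine ⟨⟨hsum.summable, T, c, hT, hsum.tsum_eq⟩, fun hd => ⟨T, c, fun s hs => ?_, hsum.tsum_eq⟩⟩
  obtain ⟨h1, -, h3, h4⟩ := hT s hs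
  rw [Finset.filter_false_of_mem fun i _ => by have := hd i; lia, Finset.card_empty,
    Nat.le_zero, List.count_eq_zero] at h4
  refine ⟨h1, fun a ha => ⟨?_, (h3 a ha).2⟩⟩
  have h5 : a ≠ 1 := fun h => h4 (h ▸ ha)
  have := (h3 a ha).1
  lia
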